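/- arXiv:1307.5482 — 2 statements merged into one kernel-verified Lean document; each statement's English description precedes it below -/
import Mathlib

section
/- Let C₁ = K(x₁, r₁), C₂ = K(x₂, r₂), C₃ = K(x₃, r₃) be circles with rᵢ > 0 such that each pair crosses in two points, i.e. |rᵢ − rⱼ| < ‖xᵢ − xⱼ‖ < rᵢ + rⱼ for all i ≠ j, and such that no point lies on all three circles (C₁ ∩ C₂ ∩ C₃ = ∅). Then the Apollonius problem for (C₁, C₂, C₃) has exactly 8 solutions. -/
open RealInnerProductSpace

noncomputable section

/-- The Euclidean plane. -/
abbrev Pl := EuclideanSpace ℝ (Fin 2)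

/-- The circle of center `x` and radius `r` in the Euclidean plane. -/
def K (x : Pl) (r : ℝ) : Set Pl := {p | dist p x = r}

/-- Two circles, given by centers and (positive) radii, are tangent. -/
def CircleTangent (y : Pl) (s : ℝ) (x : Pl) (r : ℝ) : Prop :=
  dist y x = s + r ∨ dist y x = |s - r|

/-- A line (a 1-dimensional affine subspace of the plane) is tangent to a circle iff it
meets it in exactly one point. -/
def LineTangent (L : AffineSubspace ℝ Pl) (x : Pl) (r : ℝ) : Prop :=
  ∃! p, p ∈ (L : Set Pl) ∩ K x r

/-- Solutions of the Apollonius problem for three circles with centers `x i` and radii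
`r i`: a solution is either a circle `(y, s)` with `s > 0` tangent to all three, or a
line (1-dimensional affine subspace) tangent to all three, or a point lying on all
three. The solution set is the disjoint union (sum type) of these three sets. -/
def ApolloniusSolutions (x : Fin 3 → Pl) (r : Fin 3 → ℝ) : Type :=
  {ys : Pl × ℝ // 0 < ys.2 ∧ ∀ i, CircleTangent ys.1 ys.2 (x i) (r i)} ⊕
  {L : AffineSubspace ℝ Pl // Module.finrank ℝ L.direction = 1 ∧
    ∀ i, LineTangent L (x i) (r i)} ⊕
  {p : Pl // ∀ i, p ∈ K (x i) (r i)}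



def sg (e : Bool) : ℝ := if e then 1 else -1

def gA (x z : Pl) (d : ℝ) : ℝ := (z 0 - x 0)^2 + (z 1 - x 1)^2 - d^2

def hA (x z : Pl) (d : ℝ) (b : Pl) : ℝ := b 0 * (z 0 - x 0) + b 1 * (z 1 - x 1) - d

lemma dist_sq' (x y : Pl) : dist x y ^ 2 = (x 0 - y 0)^2 + (x 1 - y 1)^2 := by
  rw [EuclideanSpace.dist_eq, Real.sq_sqrt (by positivity)]
  simp [Fin.sum_univ_two, Real.dist_eq, sq_abs]

lemma norm_sub_sq' (x y : Pl) : ‖x - y‖ ^ 2 = (x 0 - y 0)^2 + (x 1 - y 1)^2 := by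
  rw [← dist_eq_norm, dist_sq']

lemma inner' (x y : Pl) : inner ℝ x y = x 0 * y 0 + x 1 * y 1 := by
  simp [PiLp.inner_apply, Fin.sum_univ_two]; ring

lemma memK (p x : Pl) (r : ℝ) (hr : 0 < r) :
    p ∈ K x r ↔ (p 0 - x 0)^2 + (p 1 - x 1)^2 = r^2 := by
  rw [← dist_sq', K, Set.mem_ofPred_eq]
  constructor
  · intro h; rw [h]
  · intro h; exact (sq_eq_sq₀ dist_nonneg hr.le).1 h

lemma ct_iff (y x : Pl) (s r : ℝ) (hs : s ≠ 0) (hr : 0 < r) :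
    CircleTangent y |s| x r ↔ ∃ e, (y 0 - x 0)^2 + (y 1 - x 1)^2 = (s - sg e * r)^2 := by
  rw [← dist_sq', CircleTangent]
  have h1 : dist y x = |s| + r ↔ dist y x ^ 2 = (|s| + r)^2 :=
    (sq_eq_sq₀ dist_nonneg (by positivity)).symm
  have h2 : dist y x = |(|s| - r)| ↔ dist y x ^ 2 = (|s| - r)^2 := by
    rw [← sq_abs (|s| - r)]
    exact (sq_eq_sq₀ dist_nonneg (abs_nonneg _)).symm
  rw [h1, h2, Bool.exists_bool]
  simp only [sg, Bool.false_eq_true, if_true, if_false]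
  rcases abs_cases s with ⟨h, _⟩ | ⟨h, _⟩ <;> rw [h] <;> ring_nf <;> tauto

lemma sg_inj (s r : ℝ) (hs : s ≠ 0) (hr : 0 < r) (e e' : Bool)
    (h : (s - sg e * r)^2 = (s - sg e' * r)^2) : e = e' := by
  have : s * r ≠ 0 := mul_ne_zero hs hr.ne'
  cases e <;> cases e' <;> simp [sg] at h ⊢ <;> exact this (by linarith)

lemma plext (x y : Pl) (h0 : x 0 = y 0) (h1 : x 1 = y 1) : x = y := by
  ext i; fin_cases i <;> assumption

/-- the line through `z` with normal `b` -/
def ln (z b : Pl) : AffineSubspace ℝ Pl := AffineSubspace.mk' z (ℝ ∙ b)ᗮ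

lemma mem_ln (z b p : Pl) : p ∈ ln z b ↔ b 0 * (p 0 - z 0) + b 1 * (p 1 - z 1) = 0 := by
  rw [ln, AffineSubspace.mem_mk', Submodule.mem_orthogonal_singleton_iff_inner_right, inner']
  simp

lemma finrank_orth (b : Pl) (hb : b 0 ^ 2 + b 1 ^ 2 = 1) :
    Module.finrank ℝ (ℝ ∙ b)ᗮ = 1 := by
  have : Fact (Module.finrank ℝ Pl = 1 + 1) := ⟨by simp⟩
  apply Submodule.finrank_orthogonal_span_singleton
  rintro rfl
  simp at hb

lemma lt_iff (z b x : Pl) (hb : b 0 ^ 2 + b 1 ^ 2 = 1) (r : ℝ) (hr : 0 < r) :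
    LineTangent (ln z b) x r ↔ (b 0 * (x 0 - z 0) + b 1 * (x 1 - z 1))^2 = r^2 := by
  set c := b 0 * (x 0 - z 0) + b 1 * (x 1 - z 1) with hc
  unfold LineTangent
  simp only [Set.mem_inter_iff, SetLike.mem_coe, mem_ln, memK _ _ _ hr]
  constructor
  · rintro ⟨p, ⟨h1, h2⟩, h3⟩
    have h4 := h3 ((2:ℝ) • (x - c • b) - p) ?_
    · have e0 := congrArg (fun v : Pl => v 0) h4
      have e1 := congrArg (fun v : Pl => v 1) h4
      simp at e0 e1
      have e0' : p 0 = x 0 - c * b 0 := by linarith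
      have e1' : p 1 = x 1 - c * b 1 := by linarith
      rw [e0', e1'] at h2
      linear_combination h2 - c^2 * hb
    · simp
      constructor
      · linear_combination (-2 * c) * hb - h1 - 2 * hc
      · linear_combination h2 + 4 * c ^ 2 * hb + 4 * c * h1 + 4 * c * hc
  · intro h
    refine ⟨x - c • b, ⟨?_, ?_⟩, ?_⟩
    · simp
      linear_combination (-c) * hb - hc
    · simp
      linear_combination h + c^2 * hb
    · rintro p ⟨h1, h2⟩
      have key : (p 0 - x 0 + c * b 0)^2 + (p 1 - x 1 + c * b 1)^2 = 0 := by
        linear_combination h2 - h + c ^ 2 * hb + 2 * c * h1 + 2 * c * hc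
      have k0 : p 0 - x 0 + c * b 0 = 0 := by nlinarith [sq_nonneg (p 0 - x 0 + c * b 0), sq_nonneg (p 1 - x 1 + c * b 1)]
      have k1 : p 1 - x 1 + c * b 1 = 0 := by nlinarith [sq_nonneg (p 0 - x 0 + c * b 0), sq_nonneg (p 1 - x 1 + c * b 1)]
      apply plext <;> simp <;> linarith

lemma line_form (L : AffineSubspace ℝ Pl) (hL : Module.finrank ℝ L.direction = 1) (x : Pl) (r : ℝ)
    (hr : 0 < r) (ht : LineTangent L x r) :
    ∃ b : Pl, b 0 ^ 2 + b 1 ^ 2 = 1 ∧ L = ln (x - r • b) b := by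
  obtain ⟨z, ⟨h1, h2⟩, h3⟩ := ht
  rw [memK _ _ _ hr] at h2
  rw [SetLike.mem_coe] at h1
  refine ⟨r⁻¹ • (x - z), ?_, ?_⟩
  · simp
    field_simp
    linarith
  have hz : x - r • r⁻¹ • (x - z) = z := by
    rw [smul_smul, mul_inv_cancel₀ hr.ne', one_smul]; abel
  have hb : (r⁻¹ • (x - z)) 0 ^ 2 + (r⁻¹ • (x - z)) 1 ^ 2 = 1 := by
    simp
    field_simp
    linarith
  rw [hz]
  set b := r⁻¹ • (x - z) with hbd
  have b0 : r * b 0 = x 0 - z 0 := by simp [hbd]; field_simp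
  have b1 : r * b 1 = x 1 - z 1 := by simp [hbd]; field_simp
  have hle : L.direction ≤ (ℝ ∙ b)ᗮ := by
    intro v hv
    rw [Submodule.mem_orthogonal_singleton_iff_inner_right, inner']
    by_cases hv0 : v = 0
    · simp [hv0]
    have hvp : v 0 ^ 2 + v 1 ^ 2 ≠ 0 := by
      intro h
      apply hv0
      apply plext <;> simp <;> nlinarith [sq_nonneg (v 0), sq_nonneg (v 1)]
    set l := 2 * r * (b 0 * v 0 + b 1 * v 1) / (v 0 ^ 2 + v 1 ^ 2) with hl
    have hl' : l * (v 0 ^ 2 + v 1 ^ 2) = 2 * r * (b 0 * v 0 + b 1 * v 1) := by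
      rw [hl]; field_simp
    have h4 := h3 (l • v + z) ⟨?_, ?_⟩
    · have : l • v = 0 := by simpa using h4
      rcases smul_eq_zero.1 this with h | h
      · rw [h] at hl'
        have : (2 * r) * (b 0 * v 0 + b 1 * v 1) = 0 := by linarith
        rcases mul_eq_zero.1 this with h | h
        · linarith
        · exact h
      · exact absurd h hv0
    · exact AffineSubspace.vadd_mem_of_mem_direction (Submodule.smul_mem _ _ hv) h1
    · rw [memK _ _ _ hr]
      simp
      linear_combination h2 + l * hl' + 2 * l * v 0 * b0 + 2 * l * v 1 * b1
  have heq : L.direction = (ℝ ∙ b)ᗮ :=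
    Submodule.eq_of_le_of_finrank_eq hle (by rw [hL, finrank_orth b hb])
  rw [ln, ← heq]
  exact (AffineSubspace.mk'_eq h1).symm

lemma card_dir (m0 m1 k : ℝ) (h : k^2 < m0^2 + m1^2) :
    {b : Pl | b 0 ^ 2 + b 1 ^ 2 = 1 ∧ b 0 * m0 + b 1 * m1 = k}.ncard = 2 := by
  set w := √(m0^2+m1^2-k^2) with hw
  have hw2 : w^2 = m0^2+m1^2-k^2 := Real.sq_sqrt (by linarith)
  have hwp : 0 < w := Real.sqrt_pos.2 (by linarith)
  have hM : 0 < m0^2+m1^2 := lt_of_le_of_lt (sq_nonneg _) h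
  set M := m0^2+m1^2 with hMd
  rw [Set.ncard_eq_two]
  refine ⟨!₂[(k*m0 - w * m1)/M, (k*m1 + w*m0)/M], !₂[(k*m0 + w * m1)/M, (k*m1 - w*m0)/M], ?_, ?_⟩
  · intro h
    have e0 := congrArg (fun v : Pl => v 0) h
    have e1 := congrArg (fun v : Pl => v 1) h
    simp at e0 e1
    field_simp at e0 e1
    have f0 : w * m1 = 0 := by linarith
    have f1 : w * m0 = 0 := by linarith
    have : w^2*M = 0 := by rw [hMd]; linear_combination w * m1 * f0 + w*m0*f1
    have : 0 < w^2*M := by positivity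
    linarith
  · ext b
    simp only [Set.mem_ofPred_eq, Set.mem_insert_iff, Set.mem_singleton_iff]
    constructor
    · rintro ⟨g1, g2⟩
      have : (b 1 * m0 - b 0 * m1 - w) * (b 1 * m0 - b 0 * m1 + w) = 0 := by
        have : (b 0 ^2 + b 1 ^2) * M = M := by rw [g1, one_mul]
        rw [hMd] at *
        linear_combination this - hw2 - (b 0 * m0 + b 1 * m1 + k) * g2
      rcases mul_eq_zero.1 this with g | g
      · left
        apply plext <;> simp <;> field_simp <;> rw [hMd]
        · linear_combination m0 * g2 - m1 * g
        · linear_combination m1 * g2 + m0 * g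
      · right
        apply plext <;> simp <;> field_simp <;> rw [hMd]
        · linear_combination m0 * g2 - m1 * g
        · linear_combination m1 * g2 + m0 * g
    · rintro (rfl | rfl)
      · simp
        field_simp
        constructor
        · rw [hMd] at *; linear_combination (m0^2+m1^2) * hw2
        · rw [hMd]; ring
      · simp
        field_simp
        constructor
        · rw [hMd] at *; linear_combination (m0^2+m1^2) * hw2
        · rw [hMd]; ring

/-- parameters: sign choices and unit directions -/
def TT (x₁ x₂ x₃ : Pl) (r₁ r₂ r₃ : ℝ) (e : Bool × Bool) (b : Pl) : Prop :=
  b 0 ^ 2 + b 1 ^ 2 = 1 ∧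
    gA x₁ x₃ (sg e.2 * r₃ - r₁) * hA x₁ x₂ (sg e.1 * r₂ - r₁) b =
    gA x₁ x₂ (sg e.1 * r₂ - r₁) * hA x₁ x₃ (sg e.2 * r₃ - r₁) b

def aa (x₁ x₂ : Pl) (r₁ r₂ : ℝ) (e : Bool × Bool) (b : Pl) : ℝ :=
  2 * hA x₁ x₂ (sg e.1 * r₂ - r₁) b / gA x₁ x₂ (sg e.1 * r₂ - r₁)

lemma g_sign (x z : Pl) (r s : ℝ) (hr : 0 < r) (hs : 0 < s)
    (h : |r - s| < ‖x - z‖ ∧ ‖x - z‖ < r + s) :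
    0 < gA x z (s - r) ∧ gA x z (-s - r) < 0 := by
  have e := norm_sub_sq' x z
  have h1 : (r - s)^2 < ‖x - z‖^2 := by
    rw [← sq_abs]; exact pow_lt_pow_left₀ h.1 (abs_nonneg _) (by norm_num)
  have h2 : ‖x - z‖^2 < (r + s)^2 := pow_lt_pow_left₀ h.2 (norm_nonneg _) (by norm_num)
  unfold gA
  constructor <;> nlinarith

lemma g_ne (x z : Pl) (r s : ℝ) (hr : 0 < r) (hs : 0 < s)
    (h : |r - s| < ‖x - z‖ ∧ ‖x - z‖ < r + s) (e : Bool) :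
    gA x z (sg e * s - r) ≠ 0 := by
  have := g_sign x z r s hr hs h
  cases e
  · simpa [sg] using this.2.ne
  · simpa [sg] using this.1.ne'

lemma card_TT (x₁ x₂ x₃ : Pl) (r₁ r₂ r₃ : ℝ)
    (h₁ : 0 < r₁) (h₂ : 0 < r₂) (h₃ : 0 < r₃)
    (h₁₂ : |r₁ - r₂| < ‖x₁ - x₂‖ ∧ ‖x₁ - x₂‖ < r₁ + r₂)
    (h₁₃ : |r₁ - r₃| < ‖x₁ - x₃‖ ∧ ‖x₁ - x₃‖ < r₁ + r₃)
    (h₂₃ : |r₂ - r₃| < ‖x₂ - x₃‖ ∧ ‖x₂ - x₃‖ < r₂ + r₃) (e : Bool × Bool) :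
    {b | TT x₁ x₂ x₃ r₁ r₂ r₃ e b}.ncard = 2 := by
  set A := gA x₁ x₂ (sg e.1 * r₂ - r₁) with hA'
  set B := gA x₁ x₃ (sg e.2 * r₃ - r₁) with hB'
  have pos : 0 < A * B * gA x₂ x₃ (sg e.2 * r₃ - sg e.1 * r₂) := by
    have a := g_sign _ _ _ _ h₁ h₂ h₁₂
    have b := g_sign _ _ _ _ h₁ h₃ h₁₃
    have c := g_sign _ _ _ _ h₂ h₃ h₂₃
    rw [hA', hB']
    obtain ⟨e1, e2⟩ := e
    cases e1 <;> cases e2 <;> simp only [sg, Bool.false_eq_true, if_true, if_false, one_mul, neg_one_mul]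
    · have : gA x₂ x₃ (-r₃ - -r₂) = gA x₂ x₃ (r₃ - r₂) := by unfold gA; ring
      rw [this]
      exact mul_pos (mul_pos_of_neg_of_neg a.2 b.2) c.1
    · have : gA x₂ x₃ (r₃ - -r₂) = gA x₂ x₃ (-r₃ - r₂) := by unfold gA; ring
      rw [this]
      exact mul_pos_of_neg_of_neg (mul_neg_of_neg_of_pos a.2 b.1) c.2
    · exact mul_pos_of_neg_of_neg (mul_neg_of_pos_of_neg a.1 b.2) c.2
    · exact mul_pos (mul_pos a.1 b.1) c.1
  have key := card_dir (B * (x₂ 0 - x₁ 0) - A * (x₃ 0 - x₁ 0)) (B * (x₂ 1 - x₁ 1) - A * (x₃ 1 - x₁ 1))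
    (B * (sg e.1 * r₂ - r₁) - A * (sg e.2 * r₃ - r₁)) (by
      have : (B * (x₂ 0 - x₁ 0) - A * (x₃ 0 - x₁ 0))^2 + (B * (x₂ 1 - x₁ 1) - A * (x₃ 1 - x₁ 1))^2
        - (B * (sg e.1 * r₂ - r₁) - A * (sg e.2 * r₃ - r₁))^2
        = A * B * gA x₂ x₃ (sg e.2 * r₃ - sg e.1 * r₂) := by
        clear pos
        rw [hA', hB']; unfold gA; ring
      linarith)
  rw [← key]
  congr 1
  ext b
  simp only [Set.mem_ofPred_eq, TT, ← hA', ← hB']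
  apply and_congr_right
  intro _
  unfold hA
  constructor <;> intro h <;> linear_combination h

lemma aa_spec (x₁ x₂ x₃ : Pl) (r₁ r₂ r₃ : ℝ)  (h₁ : 0 < r₁) (h₂ : 0 < r₂) 
    (h₁₂ : |r₁ - r₂| < ‖x₁ - x₂‖ ∧ ‖x₁ - x₂‖ < r₁ + r₂) (e : Bool × Bool) (b : Pl)
    (h : TT x₁ x₂ x₃ r₁ r₂ r₃ e b) :
    aa x₁ x₂ r₁ r₂ e b * gA x₁ x₂ (sg e.1 * r₂ - r₁) = 2 * hA x₁ x₂ (sg e.1 * r₂ - r₁) b ∧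
    aa x₁ x₂ r₁ r₂ e b * gA x₁ x₃ (sg e.2 * r₃ - r₁) = 2 * hA x₁ x₃ (sg e.2 * r₃ - r₁) b := by
  have h0 := g_ne _ _ _ _ h₁ h₂ h₁₂ e.1
  have h2 := h.2
  unfold aa
  constructor
  · field_simp
  · field_simp
    linarith

lemma aa_eq (x₁ x₂ x₃ : Pl) (r₁ r₂ r₃ : ℝ)  (h₁ : 0 < r₁) (h₂ : 0 < r₂) 
    (h₁₂ : |r₁ - r₂| < ‖x₁ - x₂‖ ∧ ‖x₁ - x₂‖ < r₁ + r₂) (e : Bool × Bool) (b : Pl) (a : ℝ)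
    (hb : b 0 ^ 2 + b 1 ^ 2 = 1)
    (ha : a * gA x₁ x₂ (sg e.1 * r₂ - r₁) = 2 * hA x₁ x₂ (sg e.1 * r₂ - r₁) b)
    (ha' : a * gA x₁ x₃ (sg e.2 * r₃ - r₁) = 2 * hA x₁ x₃ (sg e.2 * r₃ - r₁) b) :
    TT x₁ x₂ x₃ r₁ r₂ r₃ e b ∧ aa x₁ x₂ r₁ r₂ e b = a := by
  have h0 := g_ne _ _ _ _ h₁ h₂ h₁₂ e.1
  refine ⟨⟨hb, ?_⟩, ?_⟩
  · linear_combination (-1/2) * gA x₁ x₃ (sg e.2 * r₃ - r₁) * ha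
      + (1/2) * gA x₁ x₂ (sg e.1 * r₂ - r₁) * ha'
  · unfold aa
    field_simp
    linarith

/-- `|y-z|² = (s-ρ)²` where `y = x + a⁻¹ b`, `s = r + a⁻¹` -/
lemma dist_form (x z b : Pl) (a r ρ : ℝ) (ha : a ≠ 0) (hb : b 0 ^ 2 + b 1 ^ 2 = 1) :
    a * gA x z (ρ - r) = 2 * hA x z (ρ - r) b ↔
    ((x + a⁻¹ • b) 0 - z 0)^2 + ((x + a⁻¹ • b) 1 - z 1)^2 = (r + a⁻¹ - ρ)^2 := by
  have hi : a * a⁻¹ = 1 := mul_inv_cancel₀ ha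
  simp only [PiLp.add_apply, PiLp.smul_apply, smul_eq_mul]
  unfold gA hA
  set i := a⁻¹
  have hi0 : i ≠ 0 := by rintro h; rw [h] at hi; simp at hi
  constructor
  · intro h
    linear_combination i * h + i^2 * hb - ((z 0 - x 0)^2 + (z 1 - x 1)^2 - (ρ - r)^2) * hi
  · intro h
    apply mul_left_cancel₀ hi0
    linear_combination h - i^2 * hb + ((z 0 - x 0)^2 + (z 1 - x 1)^2 - (ρ - r)^2) * hi

open Classical in
def FF (x₁ x₂ : Pl) (r₁ r₂ : ℝ) (t : (Bool × Bool) × Pl) :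
    (Pl × ℝ) ⊕ AffineSubspace ℝ Pl :=
  if aa x₁ x₂ r₁ r₂ t.1 t.2 = 0 then Sum.inr (ln (x₁ - r₁ • t.2) t.2)
  else Sum.inl (x₁ + (aa x₁ x₂ r₁ r₂ t.1 t.2)⁻¹ • t.2, |r₁ + (aa x₁ x₂ r₁ r₂ t.1 t.2)⁻¹|)

def Sol (x : Fin 3 → Pl) (r : Fin 3 → ℝ) : (Pl × ℝ) ⊕ AffineSubspace ℝ Pl → Prop
  | Sum.inl ys => 0 < ys.2 ∧ ∀ i, CircleTangent ys.1 ys.2 (x i) (r i)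
  | Sum.inr L => Module.finrank ℝ L.direction = 1 ∧ ∀ i, LineTangent L (x i) (r i)

lemma bij (x₁ x₂ x₃ : Pl) (r₁ r₂ r₃ : ℝ)
    (h₁ : 0 < r₁) (h₂ : 0 < r₂) (h₃ : 0 < r₃)
    (h₁₂ : |r₁ - r₂| < ‖x₁ - x₂‖ ∧ ‖x₁ - x₂‖ < r₁ + r₂)
    (hno : K x₁ r₁ ∩ K x₂ r₂ ∩ K x₃ r₃ = ∅) :
    Set.BijOn (FF x₁ x₂ r₁ r₂) {t | TT x₁ x₂ x₃ r₁ r₂ r₃ t.1 t.2}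
      {S | Sol ![x₁, x₂, x₃] ![r₁, r₂, r₃] S} := by
  have sq (e : Bool) (r : ℝ) : (sg e * r)^2 = r^2 := by cases e <;> simp [sg]
  -- equations in the circle case
  have circ : ∀ (e : Bool × Bool) (b : Pl) (_ : TT x₁ x₂ x₃ r₁ r₂ r₃ e b) (a : ℝ)
      (_ : aa x₁ x₂ r₁ r₂ e b = a) (_ : a ≠ 0),
      ((x₁ + a⁻¹ • b) 0 - x₁ 0)^2 + ((x₁ + a⁻¹ • b) 1 - x₁ 1)^2 = (r₁ + a⁻¹ - sg true * r₁)^2 ∧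
      ((x₁ + a⁻¹ • b) 0 - x₂ 0)^2 + ((x₁ + a⁻¹ • b) 1 - x₂ 1)^2 = (r₁ + a⁻¹ - sg e.1 * r₂)^2 ∧
      ((x₁ + a⁻¹ • b) 0 - x₃ 0)^2 + ((x₁ + a⁻¹ • b) 1 - x₃ 1)^2 = (r₁ + a⁻¹ - sg e.2 * r₃)^2 ∧
      r₁ + a⁻¹ ≠ 0 := by
    intro e b hT a ha ha0
    obtain ⟨s1, s2⟩ := aa_spec _ _ _ _ _ _ h₁ h₂ h₁₂ e b hT
    rw [ha] at s1 s2
    have q1 : ((x₁ + a⁻¹ • b) 0 - x₁ 0)^2 + ((x₁ + a⁻¹ • b) 1 - x₁ 1)^2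
        = (r₁ + a⁻¹ - sg true * r₁)^2 := by
      simp [sg]
      linear_combination a⁻¹^2 * hT.1
    have q2 := (dist_form _ _ _ _ _ _ ha0 hT.1).1 s1
    have q3 := (dist_form _ _ _ _ _ _ ha0 hT.1).1 s2
    refine ⟨q1, q2, q3, fun h0 => ?_⟩
    rw [h0, zero_sub, neg_sq, sq] at q1 q2 q3
    have : x₁ + a⁻¹ • b ∈ K x₁ r₁ ∩ K x₂ r₂ ∩ K x₃ r₃ :=
      ⟨⟨(memK _ _ _ h₁).2 q1, (memK _ _ _ h₂).2 q2⟩, (memK _ _ _ h₃).2 q3⟩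
    rw [hno] at this
    exact this
  refine ⟨?_, ?_, ?_⟩
  · rintro ⟨e, b⟩ hT
    change TT x₁ x₂ x₃ r₁ r₂ r₃ e b at hT
    change Sol _ _ _
    unfold FF
    simp only
    split_ifs with ha
    · obtain ⟨s1, s2⟩ := aa_spec _ _ _ _ _ _ h₁ h₂ h₁₂ e b hT
      rw [ha] at s1 s2
      unfold hA at s1 s2
      refine ⟨?_, ?_⟩
      · rw [ln, AffineSubspace.direction_mk']; exact finrank_orth b hT.1
      · intro i
        fin_cases i
        · refine (lt_iff _ _ x₁ hT.1 _ h₁).2 ?_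
          have : b 0 * (x₁ 0 - (x₁ - r₁ • b) 0) + b 1 * (x₁ 1 - (x₁ - r₁ • b) 1) = r₁ := by
            simp; linear_combination r₁ * hT.1
          rw [this]
        · refine (lt_iff _ _ x₂ hT.1 _ h₂).2 ?_
          have : b 0 * (x₂ 0 - (x₁ - r₁ • b) 0) + b 1 * (x₂ 1 - (x₁ - r₁ • b) 1) = sg e.1 * r₂ := by
            simp; linear_combination r₁ * hT.1 - s1 / 2
          rw [this, sq]
        · refine (lt_iff _ _ x₃ hT.1 _ h₃).2 ?_
          have : b 0 * (x₃ 0 - (x₁ - r₁ • b) 0) + b 1 * (x₃ 1 - (x₁ - r₁ • b) 1) = sg e.2 * r₃ := by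
            simp; linear_combination r₁ * hT.1 - s2 / 2
          rw [this, sq]
    · obtain ⟨q1, q2, q3, q4⟩ := circ e b hT _ rfl ha
      refine ⟨abs_pos.2 q4, ?_⟩
      intro i
      fin_cases i
      · exact (ct_iff _ _ _ _ q4 h₁).2 ⟨_, q1⟩
      · exact (ct_iff _ _ _ _ q4 h₂).2 ⟨_, q2⟩
      · exact (ct_iff _ _ _ _ q4 h₃).2 ⟨_, q3⟩
  · rintro ⟨⟨e2, e3⟩, b⟩ hT ⟨⟨e2', e3'⟩, b'⟩ hT' hF
    change TT x₁ x₂ x₃ r₁ r₂ r₃ (e2, e3) b at hT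
    change TT x₁ x₂ x₃ r₁ r₂ r₃ (e2', e3') b' at hT'
    unfold FF at hF
    simp only at hF
    split_ifs at hF with ha ha' ha'
    · have hF := Sum.inr_injective hF
      have hb : b = b' := by
        have ht : LineTangent (ln (x₁ - r₁ • b) b) x₁ r₁ := by
          refine (lt_iff _ _ _ hT.1 _ h₁).2 ?_
          have : b 0 * (x₁ 0 - (x₁ - r₁ • b) 0) + b 1 * (x₁ 1 - (x₁ - r₁ • b) 1) = r₁ := by
            simp; linear_combination r₁ * hT.1
          rw [this]
        have := ht.unique (y₁ := x₁ - r₁ • b) (y₂ := x₁ - r₁ • b') ⟨?_, ?_⟩ ⟨?_, ?_⟩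
        · have : r₁ • b = r₁ • b' := by simpa using this
          exact smul_right_injective _ h₁.ne' this
        · exact (mem_ln _ _ _).2 (by simp)
        · rw [memK _ _ _ h₁]; simp; linear_combination r₁^2 * hT.1
        · rw [hF]; exact (mem_ln _ _ _).2 (by simp)
        · rw [memK _ _ _ h₁]; simp; linear_combination r₁^2 * hT'.1
      subst hb
      obtain ⟨s1, s2⟩ := aa_spec _ _ _ _ _ _ h₁ h₂ h₁₂ _ b hT
      obtain ⟨s1', s2'⟩ := aa_spec _ _ _ _ _ _ h₁ h₂ h₁₂ _ b hT'
      rw [ha] at s1 s2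
      rw [ha'] at s1' s2'
      unfold hA at s1 s2 s1' s2'
      simp only at s1 s2 s1' s2'
      have k1 : sg e2 * r₂ = sg e2' * r₂ := by linarith
      have k2 : sg e3 * r₃ = sg e3' * r₃ := by linarith
      have := sg_inj r₂ r₂ h₂.ne' h₂ e2 e2' (by rw [k1])
      have := sg_inj r₃ r₃ h₃.ne' h₃ e3 e3' (by rw [k2])
      simp [*]
    · have hF := Sum.inl_injective hF
      obtain ⟨q1, q2, q3, q4⟩ := circ _ b hT _ rfl ha
      obtain ⟨q1', q2', q3', q4'⟩ := circ _ b' hT' _ rfl ha'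
      have hy := congrArg Prod.fst hF
      have hs := congrArg Prod.snd hF
      simp only at hy hs
      rw [← hy] at q1' q2' q3'
      set a := aa x₁ x₂ r₁ r₂ (e2, e3) b
      set a' := aa x₁ x₂ r₁ r₂ (e2', e3') b'
      have hs' : r₁ + a⁻¹ = r₁ + a'⁻¹ := by
        rcases abs_eq_abs.1 hs with h | h
        · exact h
        · exfalso
          rw [q1, h] at q1'
          have : (r₁ + a'⁻¹) * r₁ = 0 := by
            simp only [sg, if_true] at q1'
            linear_combination q1' / 4
          rcases mul_eq_zero.1 this with h | h
          · exact q4' h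
          · exact h₁.ne' h
      have haa : a⁻¹ = a'⁻¹ := by linarith
      rw [← hs'] at q2' q3'
      have t2 := sg_inj _ _ q4 h₂ e2 e2' (by rw [← q2, ← q2'])
      have t3 := sg_inj _ _ q4 h₃ e3 e3' (by rw [← q3, ← q3'])
      rw [← haa] at hy
      have : b = b' := smul_right_injective _ (inv_ne_zero ha) (by simpa using hy)
      simp [*]
  · rintro (⟨y, s⟩ | L) hS
    · change _ ∧ _ at hS
      obtain ⟨hs, ht⟩ := hS
      have t1 : CircleTangent y s x₁ r₁ := ht 0
      have t2 : CircleTangent y s x₂ r₂ := ht 1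
      have t3 : CircleTangent y s x₃ r₃ := ht 2
      simp only at hs
      obtain ⟨u, hu, hu1⟩ : ∃ u, |u| = s ∧
          (y 0 - x₁ 0)^2 + (y 1 - x₁ 1)^2 = (u - r₁)^2 := by
        rw [← abs_of_pos hs, ct_iff _ _ _ _ hs.ne' h₁] at t1
        obtain ⟨e, he⟩ := t1
        cases e
        · refine ⟨-s, by rw [abs_neg, abs_of_pos hs], ?_⟩
          rw [he]; simp only [sg, Bool.false_eq_true, if_false]; ring
        · refine ⟨s, abs_of_pos hs, ?_⟩
          rw [he]; simp only [sg, if_true]; ring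
      have hu0 : u ≠ 0 := by rintro rfl; simp at hu; linarith
      rw [← hu, ct_iff _ _ _ _ hu0 h₂] at t2
      rw [← hu, ct_iff _ _ _ _ hu0 h₃] at t3
      obtain ⟨e2, t2⟩ := t2
      obtain ⟨e3, t3⟩ := t3
      have hne : u - r₁ ≠ 0 := by
        intro h
        rw [h] at hu1
        have y0 : y 0 = x₁ 0 := by nlinarith [sq_nonneg (y 0 - x₁ 0), sq_nonneg (y 1 - x₁ 1)]
        have y1 : y 1 = x₁ 1 := by nlinarith [sq_nonneg (y 0 - x₁ 0), sq_nonneg (y 1 - x₁ 1)]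
        have := g_ne _ _ _ _ h₁ h₂ h₁₂ e2
        apply this
        unfold gA
        rw [y0, y1] at t2
        have hu : u = r₁ := by linarith
        rw [hu] at t2
        linear_combination t2
      set b := (u - r₁)⁻¹ • (y - x₁) with hb
      have hb1 : b 0 ^ 2 + b 1 ^ 2 = 1 := by
        simp [hb]
        field_simp
        linarith
      have hyb : x₁ + (u - r₁)⁻¹⁻¹ • b = y := by
        rw [hb, smul_smul, inv_mul_cancel₀ (inv_ne_zero hne), one_smul]; abel
      have hub : r₁ + (u - r₁)⁻¹⁻¹ = u := by rw [inv_inv]; ring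
      have f2 := dist_form x₁ x₂ b (u - r₁)⁻¹ r₁ (sg e2 * r₂) (inv_ne_zero hne) hb1
      have f3 := dist_form x₁ x₃ b (u - r₁)⁻¹ r₁ (sg e3 * r₃) (inv_ne_zero hne) hb1
      rw [hyb, hub] at f2 f3
      obtain ⟨g1, g2⟩ := aa_eq x₁ x₂ x₃ r₁ r₂ r₃ h₁ h₂ h₁₂ (e2, e3) b _ hb1 (f2.2 t2) (f3.2 t3)
      refine ⟨((e2, e3), b), g1, ?_⟩
      unfold FF
      simp only [g2]
      rw [if_neg (inv_ne_zero hne), hyb, hub, hu]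
    · change _ ∧ _ at hS
      obtain ⟨hf, ht⟩ := hS
      have t1 : LineTangent L x₁ r₁ := ht 0
      have t2 : LineTangent L x₂ r₂ := ht 1
      have t3 : LineTangent L x₃ r₃ := ht 2
      obtain ⟨b, hb, rfl⟩ := line_form L hf x₁ r₁ h₁ t1
      rw [lt_iff _ _ _ hb _ h₂] at t2
      rw [lt_iff _ _ _ hb _ h₃] at t3
      have ex : ∀ c r : ℝ, c^2 = r^2 → ∃ e, c = sg e * r := by
        intro c r h
        rcases sq_eq_sq_iff_eq_or_eq_neg.1 h with h | h
        · exact ⟨true, by simp [sg, h]⟩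
        · exact ⟨false, by simp [sg, h]⟩
      obtain ⟨e2, t2⟩ := ex _ _ t2
      obtain ⟨e3, t3⟩ := ex _ _ t3
      simp at t2 t3
      obtain ⟨g1, g2⟩ := aa_eq x₁ x₂ x₃ r₁ r₂ r₃ h₁ h₂ h₁₂ (e2, e3) b 0 hb
        (by unfold hA; linear_combination 2 * r₁ * hb - 2 * t2)
        (by unfold hA; linear_combination 2 * r₁ * hb - 2 * t3)
      refine ⟨((e2, e3), b), g1, ?_⟩
      unfold FF
      simp only [g2]
      exact if_pos trivial

/-- If each pair of the three circles crosses in two points and no point lies on all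
three circles, the Apollonius problem has exactly 8 solutions. -/
theorem apollonius_pairwise_crossing_eight_solutions (x₁ x₂ x₃ : Pl) (r₁ r₂ r₃ : ℝ)
    (h₁ : 0 < r₁) (h₂ : 0 < r₂) (h₃ : 0 < r₃)
    (h₁₂ : |r₁ - r₂| < ‖x₁ - x₂‖ ∧ ‖x₁ - x₂‖ < r₁ + r₂)
    (h₁₃ : |r₁ - r₃| < ‖x₁ - x₃‖ ∧ ‖x₁ - x₃‖ < r₁ + r₃)
    (h₂₃ : |r₂ - r₃| < ‖x₂ - x₃‖ ∧ ‖x₂ - x₃‖ < r₂ + r₃)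
    (hno : K x₁ r₁ ∩ K x₂ r₂ ∩ K x₃ r₃ = ∅) :
    Nat.card (ApolloniusSolutions ![x₁, x₂, x₃] ![r₁, r₂, r₃]) = 8 := by
  have hb := bij x₁ x₂ x₃ r₁ r₂ r₃ h₁ h₂ h₃ h₁₂ hno
  have hE : IsEmpty {p : Pl // ∀ i, p ∈ K (![x₁, x₂, x₃] i) (![r₁, r₂, r₃] i)} := by
    constructor
    rintro ⟨p, hp⟩
    have : p ∈ K x₁ r₁ ∩ K x₂ r₂ ∩ K x₃ r₃ := ⟨⟨hp 0, hp 1⟩, hp 2⟩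
    rw [hno] at this
    exact this
  let E1 : ApolloniusSolutions ![x₁, x₂, x₃] ![r₁, r₂, r₃] ≃
      {S // Sol ![x₁, x₂, x₃] ![r₁, r₂, r₃] S} :=
    (Equiv.sumCongr (Equiv.refl _) (Equiv.sumEmpty _ _)).trans
      (Equiv.subtypeSum (p := Sol ![x₁, x₂, x₃] ![r₁, r₂, r₃])).symm
  let E2 : {t : (Bool × Bool) × Pl // TT x₁ x₂ x₃ r₁ r₂ r₃ t.1 t.2} ≃
      {S // Sol ![x₁, x₂, x₃] ![r₁, r₂, r₃] S} := hb.equiv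
  let E3 : {t : (Bool × Bool) × Pl // TT x₁ x₂ x₃ r₁ r₂ r₃ t.1 t.2} ≃
      Σ e : Bool × Bool, {b // TT x₁ x₂ x₃ r₁ r₂ r₃ e b} :=
    Equiv.subtypeProdEquivSigmaSubtype _
  have hc : ∀ e : Bool × Bool, Nat.card {b // TT x₁ x₂ x₃ r₁ r₂ r₃ e b} = 2 := fun e =>
    card_TT x₁ x₂ x₃ r₁ r₂ r₃ h₁ h₂ h₃ h₁₂ h₁₃ h₂₃ e
  have hfin : ∀ e : Bool × Bool, Finite {b // TT x₁ x₂ x₃ r₁ r₂ r₃ e b} := fun e =>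
    Nat.finite_of_card_ne_zero (by rw [hc e]; norm_num)
  rw [Nat.card_congr (E1.trans (E2.symm.trans E3)), Nat.card_sigma]
  simp [hc]
end
end

section
/- Let C₁ = K(x₁, r₁), C₂ = K(x₂, r₂), C₃ = K(x₃, r₃) be pairwise distinct circles with rᵢ > 0 that are pairwise tangent (each pair of underlying circles meets in exactly one point) and whose three tangency points are pairwise distinct (equivalently, no point lies on all three circles). Then the Apollonius problem for (C₁, C₂, C₃) has exactly 5 solutions (among which are the three given circles themselves). -/
open RealInnerProductSpace

noncomputable section

set_option linter.all false

lemma sq_eq_one_iff_of_side {t : ℝ} (h : t ^ 2 = 1) : t = 1 ∨ t = -1 := by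
  have : (t - 1) * (t + 1) = 0 := by linarith
  rcases mul_eq_zero.mp this with h | h
  · left; linarith
  · right; linarith

abbrev V4 := Fin 4 → ℝ

def BB (v w : V4) : ℝ := v 1 * w 1 + v 2 * w 2 - (v 0 * w 3 + v 3 * w 0) / 2

lemma BB_comm (v w : V4) : BB v w = BB w v := by unfold BB; ring
lemma BB_add (v w u : V4) : BB (v + w) u = BB v u + BB w u := by simp [BB]; ring
lemma BB_sub (v w u : V4) : BB (v - w) u = BB v u - BB w u := by simp [BB]; ring
lemma BB_neg (v u : V4) : BB (-v) u = - BB v u := by simp [BB]; ring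
lemma BB_smul (t : ℝ) (v u : V4) : BB (t • v) u = t * BB v u := by simp [BB]; ring
lemma BB_add_r (v w u : V4) : BB u (v + w) = BB u v + BB u w := by simp [BB]; ring
lemma BB_sub_r (v w u : V4) : BB u (v - w) = BB u v - BB u w := by simp [BB]; ring
lemma BB_neg_r (v u : V4) : BB u (-v) = - BB u v := by simp [BB]; ring
lemma BB_smul_r (t : ℝ) (v u : V4) : BB u (t • v) = t * BB u v := by simp [BB]; ring

def d3 (a b c : V4) (i j k : Fin 4) : ℝ :=
  a i * (b j * c k - b k * c j) - a j * (b i * c k - b k * c i) + a k * (b i * c j - b j * c i)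

/-- Lorentz cross product -/
def cr (a b c : V4) : V4 :=
  ![2 * d3 a b c 0 1 2, -d3 a b c 0 2 3, d3 a b c 0 1 3, -2 * d3 a b c 1 2 3]

lemma cr1 (a b c : V4) : BB (cr a b c) a = 0 := by simp [BB, cr, d3]; ring
lemma cr2 (a b c : V4) : BB (cr a b c) b = 0 := by simp [BB, cr, d3]; ring
lemma cr3 (a b c : V4) : BB (cr a b c) c = 0 := by simp [BB, cr, d3]; ring
lemma crQ (a b c : V4) : BB (cr a b c) (cr a b c) =
   -4 * (BB a a * BB b b * BB c c + 2 * BB a b * BB b c * BB a c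
    - BB a a * BB b c ^ 2 - BB b b * BB a c ^ 2 - BB c c * BB a b ^ 2) := by
  simp [BB, cr, d3]; ring

lemma zero_of_orth (a b c n u : V4) (haa : BB a a = 1) (hbb : BB b b = 1) (hcc : BB c c = 1)
    (hab : BB a b = -1) (hac : BB a c = -1) (hbc : BB b c = -1)
    (hna : BB n a = 0) (hnb : BB n b = 0) (hnc : BB n c = 0) (hnn : BB n n = 4)
    (ha : BB u a = 0) (hb : BB u b = 0) (hc : BB u c = 0) (hn : BB u n = 0) : u = 0 := by
  let M : Matrix (Fin 4) (Fin 4) ℝ := Matrix.of ![a, b, c, n]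
  let J : Matrix (Fin 4) (Fin 4) ℝ := !![0,0,0,-1/2; 0,1,0,0; 0,0,1,0; -1/2,0,0,0]
  have key : ∀ i j, (M * J * M.transpose) i j = BB (![a, b, c, n] i) (![a, b, c, n] j) := by
    intro i j
    change _ = BB (M i) (M j)
    simp [Matrix.mul_apply, Fin.sum_univ_four, J, BB]; ring
  have hG : M * J * M.transpose = !![1,-1,-1,0; -1,1,-1,0; -1,-1,1,0; 0,0,0,4] := by
    ext i j
    rw [key]
    fin_cases i <;> fin_cases j <;> simp [*, BB_comm b a, BB_comm c a, BB_comm c b, BB_comm a n, BB_comm b n, BB_comm c n]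
  have hdet : (M * J).det ≠ 0 := by
    intro h0
    have := congrArg Matrix.det hG
    rw [Matrix.det_mul, h0] at this
    simp [Matrix.det_succ_row_zero, Fin.sum_univ_succ, Fin.succAbove] at this
    norm_num at this
  apply Matrix.eq_zero_of_mulVec_eq_zero hdet
  have key2 : ∀ i, (M * J).mulVec u i = BB u (![a, b, c, n] i) := by
    intro i
    change _ = BB u (M i)
    simp [Matrix.mulVec, dotProduct, Matrix.mul_apply, Fin.sum_univ_four, J, BB]; ring
  ext i
  rw [key2]
  fin_cases i <;> simp [*]

structure Good (a b c : V4) : Prop where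
  aa : BB a a = 1
  bb : BB b b = 1
  cc : BB c c = 1
  ab : BB a b = -1
  ac : BB a c = -1
  bc : BB b c = -1

def nn (a b c : V4) : V4 := (1/2 : ℝ) • cr a b c

lemma Good.nn {a b c : V4} (h : Good a b c) : BB (nn a b c) (nn a b c) = 4 := by
  rw [_root_.nn, BB_smul, BB_smul_r, crQ, h.aa, h.bb, h.cc, h.ab, h.ac, h.bc]; norm_num

def five (a b c : V4) : Fin 5 → V4 :=
  ![a, b, c, a + b + c + nn a b c, a + b + c - nn a b c]

lemma five_Q {a b c : V4} (h : Good a b c) (i : Fin 5) : BB (five a b c i) (five a b c i) = 1 := by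
  have h1 : BB (nn a b c) a = 0 := by simp [nn, BB_smul, cr1]
  have h2 : BB (nn a b c) b = 0 := by simp [nn, BB_smul, cr2]
  have h3 : BB (nn a b c) c = 0 := by simp [nn, BB_smul, cr3]
  have h4 := h.nn
  obtain ⟨aa, bb, cc, ab, ac, bc⟩ := h
  fin_cases i <;> simp [five, BB_add, BB_sub, BB_add_r, BB_sub_r, *, BB_comm b a, BB_comm c a, BB_comm c b, BB_comm a (nn a b c), BB_comm b (nn a b c), BB_comm c (nn a b c)] <;> norm_num

lemma five_tab {a b c : V4} (h : Good a b c) (i : Fin 5) :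
    BB (five a b c i) a = ![1,-1,-1,-1,-1] i ∧ BB (five a b c i) b = ![-1,1,-1,-1,-1] i ∧
    BB (five a b c i) c = ![-1,-1,1,-1,-1] i := by
  have h1 : BB (nn a b c) a = 0 := by simp [nn, BB_smul, cr1]
  have h2 : BB (nn a b c) b = 0 := by simp [nn, BB_smul, cr2]
  have h3 : BB (nn a b c) c = 0 := by simp [nn, BB_smul, cr3]
  obtain ⟨aa, bb, cc, ab, ac, bc⟩ := h
  fin_cases i <;> simp [five, BB_add, BB_sub, *, BB_comm b a, BB_comm c a, BB_comm c b]

lemma five_inj {a b c : V4} (h : Good a b c) (i j : Fin 5)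
    (hij : five a b c i = five a b c j ∨ five a b c i = - five a b c j) : i = j := by
  obtain ⟨a1, a2, a3⟩ := five_tab h i
  obtain ⟨b1, b2, b3⟩ := five_tab h j
  have h34 : five a b c 3 ≠ five a b c 4 := by
    intro h0
    have h5 : nn a b c = 0 := by
      ext k
      have := congrFun h0 k
      simp [five] at this
      simp
      linarith
    have := h.nn
    rw [h5] at this
    simp [BB] at this
  rcases hij with hij | hij
  · by_cases hc1 : i = 3 ∧ j = 4
    · rw [hc1.1, hc1.2] at hij; exact absurd hij h34
    by_cases hc2 : i = 4 ∧ j = 3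
    · rw [hc2.1, hc2.2] at hij; exact absurd hij.symm h34
    rw [hij, b1] at a1
    rw [hij, b2] at a2
    rw [hij, b3] at a3
    clear hij h34 b1 b2 b3
    fin_cases i <;> fin_cases j <;> simp at * <;> norm_num at *
  · rw [hij, BB_neg, b1] at a1
    rw [hij, BB_neg, b2] at a2
    rw [hij, BB_neg, b3] at a3
    clear hij h34 b1 b2 b3
    fin_cases i <;> fin_cases j <;> simp at * <;> norm_num at *

lemma five_of_tab {a b c : V4} (h : Good a b c) (v : V4) (hv : BB v v = 1) 
    (ha : BB v a = -1) (hb : BB v b = -1) (hc : BB v c = -1) :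
    v = five a b c 3 ∨ v = five a b c 4 := by
  have h1 : BB (nn a b c) a = 0 := by simp [nn, BB_smul, cr1]
  have h2 : BB (nn a b c) b = 0 := by simp [nn, BB_smul, cr2]
  have h3 : BB (nn a b c) c = 0 := by simp [nn, BB_smul, cr3]
  have h4 := h.nn
  obtain ⟨aa, bb, cc, ab, ac, bc⟩ := h
  set n := nn a b c with hn
  have hba := BB_comm b a
  have hca := BB_comm c a
  have hcb := BB_comm c b
  have han := BB_comm a n
  have hbn := BB_comm b n
  have hcn := BB_comm c n
  have hav := BB_comm a v
  have hbv := BB_comm b v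
  have hcv := BB_comm c v
  have hnv := BB_comm n v
  have hz := zero_of_orth a b c n (v - (a + b + c) - (BB v n / 4) • n) aa bb cc ab ac bc h1 h2 h3 h4
    (by simp only [BB_sub, BB_add, BB_smul]; rw [ha]; linarith [mul_comm (BB v n / 4) (BB n a), congrArg (fun t => BB v n / 4 * t) h1])
    (by simp only [BB_sub, BB_add, BB_smul]; rw [hb]; linarith [congrArg (fun t => BB v n / 4 * t) h2])
    (by simp only [BB_sub, BB_add, BB_smul]; rw [hc]; linarith [congrArg (fun t => BB v n / 4 * t) h3])
    (by simp only [BB_sub, BB_add, BB_smul]; rw [h4]; linarith)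
  set t := BB v n / 4 with ht
  have hv2 : v = a + b + c + t • n := by
    have : v = (v - (a + b + c) - t • n) + (a + b + c + t • n) := by abel
    rw [this, hz, zero_add]
  have ht2 : t ^ 2 = 1 := by
    have h5 := hv
    rw [hv2] at h5
    simp only [BB_add, BB_add_r, BB_smul, BB_smul_r] at h5
    rw [hba, hca, hcb, han, hbn, hcn, aa, bb, cc, ab, ac, bc, h1, h2, h3, h4] at h5
    linarith
  rcases sq_eq_one_iff_of_side ht2 with h | h
  · left
    rw [hv2, h, one_smul]; rfl
  · right
    rw [hv2, h, neg_one_smul, ← sub_eq_add_neg]; rfl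

lemma five_of_tab' {a b c : V4} (h : Good a b c) (v : V4) (i : Fin 5) (hi : BB (five a b c i) a = BB v a)
    (hi2 : BB (five a b c i) b = BB v b) (hi3 : BB (five a b c i) c = BB v c)
    (hv : BB v v = 1) (hx : BB v (five a b c i) = 1) : v = five a b c i := by
  have h1 : BB (nn a b c) a = 0 := by simp [nn, BB_smul, cr1]
  have h2 : BB (nn a b c) b = 0 := by simp [nn, BB_smul, cr2]
  have h3 : BB (nn a b c) c = 0 := by simp [nn, BB_smul, cr3]
  have h4 := h.nn
  have h5 := five_Q h i
  obtain ⟨aa, bb, cc, ab, ac, bc⟩ := h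
  set n := nn a b c with hn
  set f := five a b c i with hf
  have hz := zero_of_orth a b c n (v - f - (BB (v - f) n / 4) • n) aa bb cc ab ac bc h1 h2 h3 h4
    (by rw [BB_sub, BB_sub, BB_smul, h1, hi]; ring)
    (by rw [BB_sub, BB_sub, BB_smul, h2, hi2]; ring)
    (by rw [BB_sub, BB_sub, BB_smul, h3, hi3]; ring)
    (by rw [BB_sub, BB_smul, h4]; ring)
  set t := BB (v - f) n / 4 with ht
  have hv2 : v - f = t • n := sub_eq_zero.mp hz
  have ht2 : BB (v - f) (v - f) = 4 * t ^ 2 := by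
    rw [hv2, BB_smul, BB_smul_r, h4]; ring
  have hfv := BB_comm f v
  rw [BB_sub, BB_sub_r, BB_sub_r, hv, h5, hfv, hx] at ht2
  have : t = 0 := by nlinarith
  rw [this, zero_smul] at hv2
  exact sub_eq_zero.mp hv2

lemma five_surj {a b c : V4} (h : Good a b c) (v : V4) (hv : BB v v = 1)
    (ha : BB v a ^ 2 = 1) (hb : BB v b ^ 2 = 1) (hc : BB v c ^ 2 = 1) :
    ∃ i, v = five a b c i ∨ v = - five a b c i := by
  have hv' : BB (-v) (-v) = 1 := by rw [BB_neg, BB_neg_r, neg_neg, hv]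
  have T0 := five_tab h 0
  have T1 := five_tab h 1
  have T2 := five_tab h 2
  simp at T0 T1 T2
  rcases sq_eq_one_iff_of_side ha with ha | ha <;> rcases sq_eq_one_iff_of_side hb with hb | hb <;>
    rcases sq_eq_one_iff_of_side hc with hc | hc
  · rcases five_of_tab h (-v) hv' (by rw [BB_neg, ha]) (by rw [BB_neg, hb]) (by rw [BB_neg, hc]) with h | h
    · exact ⟨3, Or.inr (by rw [← h, neg_neg])⟩
    · exact ⟨4, Or.inr (by rw [← h, neg_neg])⟩
  · have := five_of_tab' h (-v) 2 (by rw [BB_neg, ha, T2.1]) (by rw [BB_neg, hb, T2.2.1])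
      (by rw [BB_neg, hc, T2.2.2]; norm_num) hv' (by change BB (-v) c = 1; rw [BB_neg, hc]; norm_num)
    exact ⟨2, Or.inr (by rw [← this, neg_neg])⟩
  · have := five_of_tab' h (-v) 1 (by rw [BB_neg, ha, T1.1]) (by rw [BB_neg, hb, T1.2.1]; norm_num)
      (by rw [BB_neg, hc, T1.2.2]) hv' (by change BB (-v) b = 1; rw [BB_neg, hb]; norm_num)
    exact ⟨1, Or.inr (by rw [← this, neg_neg])⟩
  · exact ⟨0, Or.inl (five_of_tab' h v 0 (by rw [ha, T0.1]) (by rw [hb, T0.2.1])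
      (by rw [hc, T0.2.2]) hv ha)⟩
  · have := five_of_tab' h (-v) 0 (by rw [BB_neg, ha, T0.1]; norm_num) (by rw [BB_neg, hb, T0.2.1])
      (by rw [BB_neg, hc, T0.2.2]) hv' (by change BB (-v) a = 1; rw [BB_neg, ha]; norm_num)
    exact ⟨0, Or.inr (by rw [← this, neg_neg])⟩
  · exact ⟨1, Or.inl (five_of_tab' h v 1 (by rw [ha, T1.1]) (by rw [hb, T1.2.1])
      (by rw [hc, T1.2.2]) hv hb)⟩
  · exact ⟨2, Or.inl (five_of_tab' h v 2 (by rw [ha, T2.1]) (by rw [hb, T2.2.1])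
      (by rw [hc, T2.2.2]) hv hc)⟩
  · rcases five_of_tab h v hv ha hb hc with h | h
    · exact ⟨3, Or.inl h⟩
    · exact ⟨4, Or.inl h⟩

lemma dist_sq2 (p x : Pl) : dist p x ^ 2 = (p 0 - x 0) ^ 2 + (p 1 - x 1) ^ 2 := by
  rw [EuclideanSpace.dist_eq, Real.sq_sqrt (by positivity)]
  simp [Fin.sum_univ_two, Real.dist_eq, sq_abs]

lemma mem_K_iff {p x : Pl} {r : ℝ} (hr : 0 < r) :
    p ∈ K x r ↔ (p 0 - x 0) ^ 2 + (p 1 - x 1) ^ 2 = r ^ 2 := by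
  rw [← dist_sq2]
  constructor
  · intro h; rw [show dist p x = r from h]
  · intro h
    exact (sq_eq_sq₀ dist_nonneg hr.le).mp h

lemma pl_ext {p q : Pl} (h0 : p 0 = q 0) (h1 : p 1 = q 1) : p = q := by
  ext i; fin_cases i
  · exact h0
  · exact h1

def circ (x : Pl) (r : ℝ) : V4 := ![1 / r, x 0 / r, x 1 / r, (x 0 ^ 2 + x 1 ^ 2 - r ^ 2) / r]

lemma circ_Q (x : Pl) {r : ℝ} (hr : 0 < r) : BB (circ x r) (circ x r) = 1 := by
  simp [BB, circ]; field_simp; ring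

lemma circ_BB (x y : Pl) {r s : ℝ} (hr : 0 < r) (hs : 0 < s) :
    BB (circ y s) (circ x r) = (r ^ 2 + s ^ 2 - dist y x ^ 2) / (2 * r * s) := by
  rw [dist_sq2]
  simp [BB, circ]; field_simp; ring

lemma tangent_iff (x y : Pl) {r s : ℝ} (hr : 0 < r) (hs : 0 < s) :
    CircleTangent y s x r ↔ BB (circ y s) (circ x r) ^ 2 = 1 := by
  rw [circ_BB x y hr hs]
  have hd : 0 ≤ dist y x := dist_nonneg
  unfold CircleTangent
  generalize dist y x = d at *
  have hrs : 0 < 2 * r * s := by positivity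
  constructor
  · rintro (h | h)
    · rw [h]; field_simp; ring
    · rw [h, sq_abs]; field_simp; ring
  · intro h
    rcases sq_eq_one_iff_of_side h with h | h
    · right
      rw [div_eq_iff hrs.ne'] at h
      rw [← sq_eq_sq₀ hd (abs_nonneg _), sq_abs]; linarith
    · left
      rw [div_eq_iff hrs.ne'] at h
      rw [← sq_eq_sq₀ hd (by positivity)]; linarith

def ctr (v : V4) : Pl := !₂[v 1 / v 0, v 2 / v 0]

lemma v4_ext {v w : V4} (h0 : v 0 = w 0) (h1 : v 1 = w 1) (h2 : v 2 = w 2) (h3 : v 3 = w 3) :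
    v = w := by
  ext i; fin_cases i <;> assumption

lemma circ_ctr (v : V4) (h0 : v 0 ≠ 0) (hQ : BB v v = 1) :
    circ (ctr v) (1 / |v 0|) = v ∨ circ (ctr v) (1 / |v 0|) = -v := by
  have h3 : v 3 = (v 1 ^ 2 + v 2 ^ 2 - 1) / v 0 := by
    unfold BB at hQ
    field_simp; linarith
  rcases lt_or_gt_of_ne h0 with h | h
  · right
    rw [abs_of_neg h]
    apply v4_ext <;> simp [circ, ctr] <;> try rw [h3]
    all_goals (field_simp)
  · left
    rw [abs_of_pos h]
    apply v4_ext <;> simp [circ, ctr] <;> try rw [h3]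
    all_goals (field_simp)

lemma ctr_circ (y : Pl) {s : ℝ} (hs : 0 < s) : ctr (circ y s) = y ∧ 1 / |circ y s 0| = s := by
  constructor
  · apply pl_ext <;> simp [ctr, circ] <;> field_simp
  · simp [circ, abs_of_pos hs]

def Ln (v : V4) : AffineSubspace ℝ Pl :=
  AffineSubspace.mk' !₂[v 3 / 2 * v 1, v 3 / 2 * v 2] (Submodule.span ℝ {(!₂[-v 2, v 1] : Pl)})

lemma BB0 (v : V4) (h0 : v 0 = 0) (hQ : BB v v = 1) : v 1 ^ 2 + v 2 ^ 2 = 1 := by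
  simp [BB, h0] at hQ; linarith

lemma mem_Ln (v : V4) (h : v 1 ^ 2 + v 2 ^ 2 = 1) (p : Pl) :
    p ∈ Ln v ↔ v 1 * p 0 + v 2 * p 1 = v 3 / 2 := by
  rw [Ln, AffineSubspace.mem_mk', Submodule.mem_span_singleton]
  constructor
  · rintro ⟨t, ht⟩
    have e0 := congrArg (fun q : Pl => q 0) ht
    have e1 := congrArg (fun q : Pl => q 1) ht
    simp at e0 e1
    linear_combination (-v 1) * e0 - v 2 * e1 + v 3 / 2 * h
  · intro hp
    refine ⟨-v 2 * p 0 + v 1 * p 1, ?_⟩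
    apply pl_ext
    · simp
      linear_combination v 1 * hp * (-1) + p 0 * h
    · simp
      linear_combination v 2 * hp * (-1) + p 1 * h

lemma finrank_Ln (v : V4) (h : v 1 ^ 2 + v 2 ^ 2 = 1) : Module.finrank ℝ (Ln v).direction = 1 := by
  rw [Ln, AffineSubspace.direction_mk', finrank_span_singleton]
  intro h0
  have e0 := congrArg (fun q : Pl => q 0) h0
  have e1 := congrArg (fun q : Pl => q 1) h0
  simp at e0 e1
  rw [e0, e1] at h; norm_num at h

lemma lineTangent_iff (v : V4) (h0 : v 0 = 0) (h : v 1 ^ 2 + v 2 ^ 2 = 1) (x : Pl) {r : ℝ}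
    (hr : 0 < r) : LineTangent (Ln v) x r ↔ BB v (circ x r) ^ 2 = 1 := by
  have hB : BB v (circ x r) ^ 2 = 1 ↔ (v 1 * x 0 + v 2 * x 1 - v 3 / 2) ^ 2 = r ^ 2 := by
    have : BB v (circ x r) = (v 1 * x 0 + v 2 * x 1 - v 3 / 2) / r := by
      simp [BB, circ, h0]; field_simp
    rw [this, div_pow, div_eq_one_iff_eq (by positivity)]
  rw [hB]
  unfold LineTangent
  simp only [Set.mem_inter_iff, mem_K_iff hr, SetLike.mem_coe, mem_Ln v h]
  constructor
  · rintro ⟨p, ⟨hp1, hp2⟩, hu⟩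
    set k := -v 2 * (p 0 - x 0) + v 1 * (p 1 - x 1) with hk
    have := hu !₂[p 0 - 2 * k * (-v 2), p 1 - 2 * k * v 1] (by
      simp
      constructor
      · linear_combination hp1
      · linear_combination hp2 + 4 * k ^ 2 * h - 4 * k * hk)
    have e0 := congrArg (fun q : Pl => q 0) this
    have e1 := congrArg (fun q : Pl => q 1) this
    simp at e0 e1
    have hk0 : k = 0 := by
      have e0' : k * v 2 = 0 := by rcases e0 with e | e <;> simp [e]
      have e1' : k * v 1 = 0 := by rcases e1 with e | e <;> simp [e]
      linear_combination v 2 * e0' + v 1 * e1' - k * h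
    have hk2 : -v 2 * (p 0 - x 0) + v 1 * (p 1 - x 1) = 0 := by rw [← hk, hk0]
    rw [← hp1, ← hp2]
    linear_combination ((p 0 - x 0) ^ 2 + (p 1 - x 1) ^ 2) * h - (-v 2 * (p 0 - x 0) + v 1 * (p 1 - x 1)) * hk2
  · intro hr2
    set m := v 3 / 2 - (v 1 * x 0 + v 2 * x 1) with hm
    refine ⟨!₂[x 0 + m * v 1, x 1 + m * v 2], ⟨?_, ?_⟩, ?_⟩
    · simp
      linear_combination m * h + hm
    · simp
      linear_combination hr2 + m ^ 2 * h + (m - (v 1 * x 0 + v 2 * x 1 - v 3 / 2)) * hm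
    · rintro p ⟨hp1, hp2⟩
      have hk : (-v 2 * (p 0 - x 0) + v 1 * (p 1 - x 1)) ^ 2 = 0 := by
        rw [← hp1] at hr2
        linear_combination hp2 - hr2 + ((p 0 - x 0) ^ 2 + (p 1 - x 1) ^ 2) * h
      have hk := pow_eq_zero_iff (two_ne_zero) |>.mp hk
      apply pl_ext
      · simp
        linear_combination v 1 * hp1 - v 2 * hk - (p 0 - x 0) * h + v 1 * hm
      · simp
        linear_combination v 2 * hp1 + v 1 * hk - (p 1 - x 1) * h + v 2 * hm

lemma Ln_inj (v w : V4) (hv0 : v 0 = 0) (hw0 : w 0 = 0) (hv : v 1 ^ 2 + v 2 ^ 2 = 1)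
    (hw : w 1 ^ 2 + w 2 ^ 2 = 1) (h : Ln v = Ln w) : v = w ∨ v = -w := by
  have m1 : (!₂[v 3 / 2 * v 1, v 3 / 2 * v 2] : Pl) ∈ Ln w := by
    rw [← h, mem_Ln v hv]; simp; linear_combination v 3 / 2 * hv
  have m2 : (!₂[v 3 / 2 * v 1 - v 2, v 3 / 2 * v 2 + v 1] : Pl) ∈ Ln w := by
    rw [← h, mem_Ln v hv]; simp; linear_combination v 3 / 2 * hv
  rw [mem_Ln w hw] at m1 m2
  simp at m1 m2
  have hx : w 2 * v 1 - w 1 * v 2 = 0 := by linear_combination m2 - m1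
  set t := v 1 * w 1 + v 2 * w 2 with ht
  have e1 : w 1 = t * v 1 := by linear_combination -v 2 * hx - w 1 * hv - v 1 * ht
  have e2 : w 2 = t * v 2 := by linear_combination v 1 * hx - w 2 * hv - v 2 * ht
  have e3 : w 3 = t * v 3 := by linear_combination -2 * m1 - v 3 * ht
  have t2 : t ^ 2 = 1 := by
    rw [e1, e2] at hw
    linear_combination hw - t ^ 2 * hv
  rcases sq_eq_one_iff_of_side t2 with h | h <;> rw [h] at e1 e2 e3
  · left
    apply v4_ext <;> (try simp only [Pi.neg_apply]) <;> linarith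
  · right
    apply v4_ext <;> (try simp only [Pi.neg_apply]) <;> linarith

lemma exists_Ln (L : AffineSubspace ℝ Pl) (hL : Module.finrank ℝ L.direction = 1)
    (hne : ∃ p, p ∈ L) : ∃ v : V4, v 0 = 0 ∧ v 1 ^ 2 + v 2 ^ 2 = 1 ∧ L = Ln v := by
  obtain ⟨p, hp⟩ := hne
  obtain ⟨⟨u, huL⟩, hu0, hu⟩ := finrank_eq_one_iff'.mp hL
  have hu0' : u ≠ 0 := fun h => hu0 (by simp [h])
  have hN : 0 < u 0 ^ 2 + u 1 ^ 2 := by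
    by_contra hcon
    apply hu0'
    apply pl_ext
    · simp; nlinarith [sq_nonneg (u 0), sq_nonneg (u 1)]
    · simp; nlinarith [sq_nonneg (u 0), sq_nonneg (u 1)]
  set N := Real.sqrt (u 0 ^ 2 + u 1 ^ 2) with hNd
  have hNp : 0 < N := Real.sqrt_pos.mpr hN
  have hN2 : N ^ 2 = u 0 ^ 2 + u 1 ^ 2 := Real.sq_sqrt hN.le
  let v : V4 := ![0, u 1 / N, -u 0 / N, 2 * (u 1 / N * p 0 + -u 0 / N * p 1)]
  have hv : v 1 ^ 2 + v 2 ^ 2 = 1 := by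
    simp [v]; field_simp; linarith
  refine ⟨v, rfl, hv, ?_⟩
  ext q
  rw [mem_Ln v hv]
  have hq : q ∈ L ↔ q - p ∈ L.direction := (AffineSubspace.vsub_right_mem_direction_iff_mem hp q).symm
  rw [hq]
  have hvq : v 1 * q 0 + v 2 * q 1 = v 3 / 2 ↔ u 1 * (q 0 - p 0) = u 0 * (q 1 - p 1) := by
    simp [v]; field_simp
    constructor <;> intro h <;> linarith
  rw [hvq]
  constructor
  · intro h
    obtain ⟨c, hc⟩ := hu ⟨_, h⟩
    have hc' : c • u = q - p := congrArg Subtype.val hc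
    have e0 := congrArg (fun q : Pl => q 0) hc'
    have e1 := congrArg (fun q : Pl => q 1) hc'
    simp at e0 e1
    rw [← e0, ← e1]; ring
  · intro h
    have : q - p = ((u 0 * (q 0 - p 0) + u 1 * (q 1 - p 1)) / (u 0 ^ 2 + u 1 ^ 2)) • u := by
      apply pl_ext
      · simp; field_simp; linear_combination u 1 * h
      · simp; field_simp; linear_combination -u 0 * h
    rw [this]
    exact Submodule.smul_mem _ _ huL

lemma pair_of_unique {x y : Pl} {r s : ℝ} (hr : 0 < r) (hs : 0 < s) (hne : (x, r) ≠ (y, s))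
    (ht : ∃! p, p ∈ K x r ∩ K y s) : BB (circ x r) (circ y s) ^ 2 = 1 := by
  simp only [Set.mem_inter_iff, mem_K_iff hr, mem_K_iff hs] at ht
  obtain ⟨p, ⟨h1, h2⟩, hu⟩ := ht
  rw [circ_BB y x hs hr, div_pow, div_eq_one_iff_eq (by positivity), dist_sq2]
  have hE : 0 < (x 0 - y 0) ^ 2 + (x 1 - y 1) ^ 2 := by
    by_contra hcon
    have e0 : x 0 = y 0 := by nlinarith [sq_nonneg (x 0 - y 0), sq_nonneg (x 1 - y 1)]
    have e1 : x 1 = y 1 := by nlinarith [sq_nonneg (x 0 - y 0), sq_nonneg (x 1 - y 1)]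
    apply hne
    have hxy : x = y := pl_ext e0 e1
    rw [hxy] at h1
    rw [hxy, (sq_eq_sq₀ hr.le hs.le).mp (h1.symm.trans h2)]
  set E := (x 0 - y 0) ^ 2 + (x 1 - y 1) ^ 2 with hEd
  set k := (-(p 0 - x 0) * (x 1 - y 1) + (p 1 - x 1) * (x 0 - y 0)) / E with hk
  have hkE : k * E = -(p 0 - x 0) * (x 1 - y 1) + (p 1 - x 1) * (x 0 - y 0) := by
    rw [hk]; field_simp
  have := hu !₂[p 0 + 2 * k * (x 1 - y 1), p 1 - 2 * k * (x 0 - y 0)] (by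
      simp
      constructor
      · linear_combination h1 + 4 * k * hkE - 4 * k ^ 2 * hEd
      · linear_combination h2 + 4 * k * hkE - 4 * k ^ 2 * hEd)
  have e0 := congrArg (fun q : Pl => q 0) this
  have e1 := congrArg (fun q : Pl => q 1) this
  have e0' : k * (x 1 - y 1) = 0 := by simp at e0; rcases e0 with e | e <;> simp [e]
  have e1' : k * (x 0 - y 0) = 0 := by simp at e1; rcases e1 with e | e <;> simp [e]
  have hkE0 : k * E = 0 := by
    linear_combination (x 0 - y 0) * e1' + (x 1 - y 1) * e0' + k * hEd
  rw [hkE0] at hkE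
  rw [show (2 * s * r) ^ 2 = 4 * (s ^ 2 * r ^ 2) by ring, ← h1, ← h2, hEd]
  linear_combination 4 * (-(p 0 - x 0) * (x 1 - y 1) + (p 1 - x 1) * (x 0 - y 0)) * hkE

lemma ctr_mem {w : V4} {x : Pl} {r : ℝ} (hr : 0 < r) (hw : BB w w = 0) (h0 : w 0 ≠ 0)
    (h : BB w (circ x r) = 0) : ctr w ∈ K x r := by
  rw [mem_K_iff hr]
  have h3 : w 3 = (w 1 ^ 2 + w 2 ^ 2) / w 0 := by
    unfold BB at hw
    field_simp; linarith
  simp [BB, circ] at h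
  rw [h3] at h
  simp [ctr]
  field_simp at h ⊢
  linarith

lemma ctr_eq {w u : V4} (hw : BB w w = 0) (hu : BB u u = 0) (hwu : BB w u = 0) (h0 : w 0 ≠ 0)
    (h1 : u 0 ≠ 0) : ctr w = ctr u := by
  have h3 : w 3 = (w 1 ^ 2 + w 2 ^ 2) / w 0 := by
    unfold BB at hw
    field_simp; linarith
  have h4 : u 3 = (u 1 ^ 2 + u 2 ^ 2) / u 0 := by
    unfold BB at hu
    field_simp; linarith
  have key : (w 1 / w 0 - u 1 / u 0) ^ 2 + (w 2 / w 0 - u 2 / u 0) ^ 2 = 0 := by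
    unfold BB at hwu
    rw [h3, h4] at hwu
    field_simp at hwu ⊢
    linarith
  apply pl_ext
  · simp only [ctr]; simp; nlinarith [sq_nonneg (w 1 / w 0 - u 1 / u 0), sq_nonneg (w 2 / w 0 - u 2 / u 0)]
  · simp only [ctr]; simp; nlinarith [sq_nonneg (w 1 / w 0 - u 1 / u 0), sq_nonneg (w 2 / w 0 - u 2 / u 0)]

lemma ne_zero_sum {x₁ x₂ : Pl} {r₁ r₂ : ℝ} (h₁ : 0 < r₁) (h₂ : 0 < r₂)
    (hne₁₂ : (x₁, r₁) ≠ (x₂, r₂)) (b : V4)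
    (hb : b = circ x₂ r₂ ∨ b = - circ x₂ r₂) (Qb : BB b b = 1)
    (hab : BB (circ x₁ r₁) b = -1) : (circ x₁ r₁ + b) 0 ≠ 0 := by
  intro h0
  rcases hb with hb | hb
  · rw [hb] at h0
    simp [circ] at h0
    have : 0 < r₁⁻¹ + r₂⁻¹ := by positivity
    linarith
  · have n1 : BB (circ x₁ r₁ + b) (circ x₁ r₁ + b) = 0 := by
      simp only [BB_add, BB_add_r]; linarith [circ_Q x₁ h₁, BB_comm b (circ x₁ r₁)]
    unfold BB at n1
    rw [h0] at n1
    have e1 : (circ x₁ r₁ + b) 1 = 0 := by nlinarith [sq_nonneg ((circ x₁ r₁ + b) 1), sq_nonneg ((circ x₁ r₁ + b) 2)]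
    have e2 : (circ x₁ r₁ + b) 2 = 0 := by nlinarith [sq_nonneg ((circ x₁ r₁ + b) 1), sq_nonneg ((circ x₁ r₁ + b) 2)]
    rw [hb] at h0 e1 e2
    simp [circ] at h0 e1 e2
    have hr : r₁ = r₂ := by rw [← inv_inj]; linarith
    subst hr
    apply hne₁₂
    congr 1
    apply pl_ext
    · field_simp at e1; linarith
    · field_simp at e2; linarith

lemma exists_common {x₁ x₂ x₃ : Pl} {r₁ r₂ r₃ : ℝ}
    (h₁ : 0 < r₁) (h₂ : 0 < r₂) (h₃ : 0 < r₃)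
    (hne₁₂ : (x₁, r₁) ≠ (x₂, r₂)) (hne₁₃ : (x₁, r₁) ≠ (x₃, r₃)) (b c : V4)
    (hb : b = circ x₂ r₂ ∨ b = - circ x₂ r₂) (hc : c = circ x₃ r₃ ∨ c = - circ x₃ r₃)
    (hab : BB (circ x₁ r₁) b = -1) (hac : BB (circ x₁ r₁) c = -1) (hbc : BB b c = 1) :
    ∃ p, p ∈ K x₁ r₁ ∩ K x₂ r₂ ∩ K x₃ r₃ := by
  have Qa := circ_Q x₁ h₁
  have Qb : BB b b = 1 := by
    rcases hb with rfl | rfl <;> simp [BB_neg, BB_neg_r, circ_Q _ h₂]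
  have Qc : BB c c = 1 := by
    rcases hc with rfl | rfl <;> simp [BB_neg, BB_neg_r, circ_Q _ h₃]
  have z1 := ne_zero_sum h₁ h₂ hne₁₂ b hb Qb hab
  have z2 := ne_zero_sum h₁ h₃ hne₁₃ c hc Qc hac
  set a := circ x₁ r₁ with ha
  have hba := BB_comm b a
  have hca := BB_comm c a
  have hcb := BB_comm c b
  have n1 : BB (a + b) (a + b) = 0 := by simp only [BB_add, BB_add_r]; linarith
  have n2 : BB (a + c) (a + c) = 0 := by simp only [BB_add, BB_add_r]; linarith
  have n3 : BB (a + b) (a + c) = 0 := by simp only [BB_add, BB_add_r]; linarith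
  have hcc := ctr_eq n1 n2 n3 z1 z2
  refine ⟨ctr (a + b), ⟨?_, ?_⟩, ?_⟩
  · exact ctr_mem h₁ n1 z1 (by rw [BB_add]; linarith)
  · apply ctr_mem h₂ n1 z1
    have : BB (a + b) b = 0 := by rw [BB_add]; linarith
    rcases hb with h | h
    · rw [← h, this]
    · rw [← neg_neg (circ x₂ r₂), ← h, BB_neg_r, this, neg_zero]
  · rw [hcc]
    apply ctr_mem h₃ n2 z2
    have : BB (a + c) c = 0 := by rw [BB_add]; linarith
    rcases hc with h | h
    · rw [← h, this]
    · rw [← neg_neg (circ x₃ r₃), ← h, BB_neg_r, this, neg_zero]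

lemma exists_good {x₁ x₂ x₃ : Pl} {r₁ r₂ r₃ : ℝ}
    (h₁ : 0 < r₁) (h₂ : 0 < r₂) (h₃ : 0 < r₃)
    (hne₁₂ : (x₁, r₁) ≠ (x₂, r₂)) (hne₁₃ : (x₁, r₁) ≠ (x₃, r₃))
    (hne₂₃ : (x₂, r₂) ≠ (x₃, r₃))
    (ht₁₂ : ∃! p, p ∈ K x₁ r₁ ∩ K x₂ r₂) (ht₁₃ : ∃! p, p ∈ K x₁ r₁ ∩ K x₃ r₃)
    (ht₂₃ : ∃! p, p ∈ K x₂ r₂ ∩ K x₃ r₃)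
    (hno : K x₁ r₁ ∩ K x₂ r₂ ∩ K x₃ r₃ = ∅) :
    ∃ b c, (b = circ x₂ r₂ ∨ b = - circ x₂ r₂) ∧ (c = circ x₃ r₃ ∨ c = - circ x₃ r₃) ∧
      Good (circ x₁ r₁) b c := by
  have hex : ∃ b, (b = circ x₂ r₂ ∨ b = - circ x₂ r₂) ∧ BB (circ x₁ r₁) b = -1 := by
    rcases sq_eq_one_iff_of_side (pair_of_unique h₁ h₂ hne₁₂ ht₁₂) with h | h
    · exact ⟨_, Or.inr rfl, by rw [BB_neg_r, h]⟩
    · exact ⟨_, Or.inl rfl, h⟩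
  have hex2 : ∃ b, (b = circ x₃ r₃ ∨ b = - circ x₃ r₃) ∧ BB (circ x₁ r₁) b = -1 := by
    rcases sq_eq_one_iff_of_side (pair_of_unique h₁ h₃ hne₁₃ ht₁₃) with h | h
    · exact ⟨_, Or.inr rfl, by rw [BB_neg_r, h]⟩
    · exact ⟨_, Or.inl rfl, h⟩
  obtain ⟨b, hb, hab⟩ := hex
  obtain ⟨c, hc, hac⟩ := hex2
  have hbc2 : BB b c ^ 2 = 1 := by
    rw [← pair_of_unique h₂ h₃ hne₂₃ ht₂₃]
    rcases hb with rfl | rfl <;> rcases hc with rfl | rfl <;> simp [BB_neg, BB_neg_r]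
  refine ⟨b, c, hb, hc, circ_Q _ h₁, ?_, ?_, hab, hac, ?_⟩
  · rcases hb with rfl | rfl <;> simp [BB_neg, BB_neg_r, circ_Q _ h₂]
  · rcases hc with rfl | rfl <;> simp [BB_neg, BB_neg_r, circ_Q _ h₃]
  · rcases sq_eq_one_iff_of_side hbc2 with h | h
    · obtain ⟨p, hp⟩ := exists_common h₁ h₂ h₃ hne₁₂ hne₁₃ b c hb hc hab hac h
      rw [hno] at hp; exact hp.elim
    · exact h


lemma tab_neg {v w u : V4} (h : v = w ∨ v = -w) : BB v u ^ 2 = BB w u ^ 2 := by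
  rcases h with rfl | rfl
  · rfl
  · rw [BB_neg, neg_sq]

lemma tab_neg_r {v w u : V4} (h : v = w ∨ v = -w) : BB u v ^ 2 = BB u w ^ 2 := by
  rw [BB_comm u v, BB_comm u w, tab_neg h]

abbrev ASum (x : Fin 3 → Pl) (r : Fin 3 → ℝ) : Type :=
  {ys : Pl × ℝ // 0 < ys.2 ∧ ∀ i, CircleTangent ys.1 ys.2 (x i) (r i)} ⊕
  {L : AffineSubspace ℝ Pl // Module.finrank ℝ L.direction = 1 ∧
    ∀ i, LineTangent L (x i) (r i)} ⊕
  {p : Pl // ∀ i, p ∈ K (x i) (r i)}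

open Classical in
def mkSol (x : Fin 3 → Pl) (r : Fin 3 → ℝ) (hr : ∀ i, 0 < r i) (v : V4) (hQ : BB v v = 1)
    (ht : ∀ i, BB v (circ (x i) (r i)) ^ 2 = 1) : ASum x r :=
  if h : v 0 = 0 then Sum.inr (Sum.inl ⟨Ln v, finrank_Ln v (BB0 v h hQ), fun i =>
    (lineTangent_iff v h (BB0 v h hQ) (x i) (hr i)).mpr (ht i)⟩)
  else Sum.inl ⟨(ctr v, 1 / |v 0|), by positivity, fun i =>
    (tangent_iff (x i) (ctr v) (hr i) (by positivity)).mpr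
      (by rw [tab_neg (circ_ctr v h hQ)]; exact ht i)⟩

lemma sign_trans {v w c : V4} (h1 : c = v ∨ c = -v) (h2 : c = w ∨ c = -w) : v = w ∨ v = -w := by
  rcases h1 with h1 | h1 <;> rcases h2 with h2 | h2
  · left; rw [← h1, h2]
  · right; rw [← h1, h2]
  · right; rw [← h2, h1, neg_neg]
  · left; rw [← neg_inj, ← h1, h2]

lemma mkSol_inj (x : Fin 3 → Pl) (r : Fin 3 → ℝ) (hr : ∀ i, 0 < r i) (v w : V4) (hQ hQ' ht ht')
    (h : mkSol x r hr v hQ ht = mkSol x r hr w hQ' ht') : v = w ∨ v = -w := by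
  unfold mkSol at h
  split_ifs at h with h1 h2 h2'
  · have h3 := Sum.inl.inj (Sum.inr.inj h)
    exact Ln_inj v w h1 h2 (BB0 v h1 hQ) (BB0 w h2 hQ') (congrArg Subtype.val h3)
  · have h3 := congrArg Subtype.val (Sum.inl.inj h)
    have h4 : ctr v = ctr w := congrArg Prod.fst h3
    have h5 : 1 / |v 0| = 1 / |w 0| := congrArg Prod.snd h3
    have a1 := circ_ctr v h1 hQ
    have a2 := circ_ctr w h2' hQ'
    rw [← h4, ← h5] at a2
    exact sign_trans a1 a2

lemma mkSol_surj (x : Fin 3 → Pl) (r : Fin 3 → ℝ) (hr : ∀ i, 0 < r i)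
    (hno : ∀ p, ¬ ∀ i, p ∈ K (x i) (r i)) (s : ASum x r) :
    ∃ v, BB v v = 1 ∧ (∀ i, BB v (circ (x i) (r i)) ^ 2 = 1) ∧
      ∀ w hQ ht, (v = w ∨ v = -w) → mkSol x r hr w hQ ht = s := by
  rcases s with ⟨⟨y, s⟩, hs, hy⟩ | ⟨L, hL, hy⟩ | ⟨p, hp⟩
  · refine ⟨circ y s, circ_Q y hs, fun i => (tangent_iff (x i) y (hr i) hs).mp (hy i), ?_⟩
    intro w hQ ht hw
    have hs' : 0 < s := hs
    have c1 := ctr_circ y hs'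
    have hz : circ y s 0 ≠ 0 := by simp [circ]; exact hs'.ne'
    have hw0 : w 0 ≠ 0 ∧ ctr w = y ∧ 1 / |w 0| = s := by
      rcases hw with hw | hw
      · rw [← hw]; exact ⟨hz, c1⟩
      · rw [hw] at c1 hz
        refine ⟨by simpa using hz, ?_, ?_⟩
        · rw [← c1.1]; simp [ctr]
        · rw [← c1.2]; simp
    unfold mkSol
    rw [dif_neg hw0.1]
    congr 1
    apply Subtype.ext
    exact Prod.ext hw0.2.1 hw0.2.2
  · obtain ⟨p, hp, -⟩ := hy 0
    obtain ⟨v, h0, hv, rfl⟩ := exists_Ln L hL ⟨p, hp.1⟩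
    refine ⟨v, by simp [BB, h0]; linarith, fun i => (lineTangent_iff v h0 hv (x i) (hr i)).mp (hy i), ?_⟩
    intro w hQ ht hw
    have hw0 : w 0 = 0 := by
      rcases hw with rfl | rfl
      · exact h0
      · simpa using h0
    unfold mkSol
    rw [dif_pos hw0]
    congr 2
    apply Subtype.ext
    change Ln w = Ln v
    have hw1 := BB0 w hw0 hQ
    ext q
    rw [mem_Ln w hw1, mem_Ln v hv]
    rcases hw with rfl | rfl
    · rfl
    · simp only [Pi.neg_apply]
      constructor <;> intro h <;> linarith
  · exact (hno p hp).elim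

/-- Three pairwise distinct circles that are pairwise tangent (each pair of the
underlying circles meets in exactly one point), with pairwise distinct tangency points
(equivalently, no point lies on all three circles), admit exactly 5 Apollonius
solutions. -/
theorem apollonius_pairwise_tangent_five_solutions (x₁ x₂ x₃ : Pl) (r₁ r₂ r₃ : ℝ)
    (h₁ : 0 < r₁) (h₂ : 0 < r₂) (h₃ : 0 < r₃)
    (hne₁₂ : (x₁, r₁) ≠ (x₂, r₂)) (hne₁₃ : (x₁, r₁) ≠ (x₃, r₃))
    (hne₂₃ : (x₂, r₂) ≠ (x₃, r₃))
    (ht₁₂ : ∃! p, p ∈ K x₁ r₁ ∩ K x₂ r₂) (ht₁₃ : ∃! p, p ∈ K x₁ r₁ ∩ K x₃ r₃)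
    (ht₂₃ : ∃! p, p ∈ K x₂ r₂ ∩ K x₃ r₃)
    (hno : K x₁ r₁ ∩ K x₂ r₂ ∩ K x₃ r₃ = ∅) :
    Nat.card (ApolloniusSolutions ![x₁, x₂, x₃] ![r₁, r₂, r₃]) = 5 := by
  change Nat.card (ASum ![x₁, x₂, x₃] ![r₁, r₂, r₃]) = 5
  obtain ⟨b, c, hb, hc, hG⟩ := exists_good h₁ h₂ h₃ hne₁₂ hne₁₃ hne₂₃ ht₁₂ ht₁₃ ht₂₃ hno
  have hr : ∀ i, 0 < ![r₁, r₂, r₃] i := by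
    intro i; fin_cases i <;> simp [*]
  have hno' : ∀ p, ¬ ∀ i, p ∈ K (![x₁, x₂, x₃] i) (![r₁, r₂, r₃] i) := by
    intro p hp
    have : p ∈ K x₁ r₁ ∩ K x₂ r₂ ∩ K x₃ r₃ := ⟨⟨hp 0, hp 1⟩, hp 2⟩
    rw [hno] at this; exact this
  have ht : ∀ j i, BB (five (circ x₁ r₁) b c j) (circ (![x₁, x₂, x₃] i) (![r₁, r₂, r₃] i)) ^ 2 = 1 := by
    intro j i
    obtain ⟨t1, t2, t3⟩ := five_tab hG j
    have s1 : BB (five (circ x₁ r₁) b c j) (circ x₁ r₁) ^ 2 = 1 := by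
      rw [t1]; fin_cases j <;> simp
    have s2 : BB (five (circ x₁ r₁) b c j) (circ x₂ r₂) ^ 2 = 1 := by
      rw [← tab_neg_r hb, t2]; fin_cases j <;> simp
    have s3 : BB (five (circ x₁ r₁) b c j) (circ x₃ r₃) ^ 2 = 1 := by
      rw [← tab_neg_r hc, t3]; fin_cases j <;> simp
    fin_cases i
    · exact s1
    · exact s2
    · exact s3
  let f : Fin 5 → ASum ![x₁, x₂, x₃] ![r₁, r₂, r₃] := fun j =>
    mkSol _ _ hr (five (circ x₁ r₁) b c j) (five_Q hG j) (ht j)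
  have hf : Function.Bijective f := by
    constructor
    · intro i j hij
      exact five_inj hG i j (mkSol_inj _ _ hr _ _ _ _ _ _ hij)
    · intro s
      obtain ⟨v, hv, hvt, hs⟩ := mkSol_surj _ _ hr hno' s
      obtain ⟨i, hi⟩ := five_surj hG v hv (hvt 0)
        (by rw [tab_neg_r hb]; exact hvt 1) (by rw [tab_neg_r hc]; exact hvt 2)
      exact ⟨i, hs _ _ _ hi⟩
  rw [← Nat.card_eq_of_bijective f hf]
  simp
end
end
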